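/- arXiv:2406.11876 — 3 statements merged into one kernel-verified Lean document; each statement's English description precedes it below -/
import Mathlib

section
/- Let A be a finite connected simple graph with at least one edge, let B be a finite simple graph with at least one edge, and let λ > 1 be rational. Then the lexicographic product A[B] is not edge quasi-λ-distance-balanced; in particular A[B] contains an odd cycle (a triangle) and is not bipartite. -/
open SimpleGraph

/-- Distance from a vertex to an edge (unordered pair): min of distances to the endpoints. -/
noncomputable def evdist {V : Type*} (G : SimpleGraph V) (g : V) (e : Sym2 V) : ℕ :=
  Sym2.lift ⟨fun u v => min (G.dist g u) (G.dist g v), fun _ _ => min_comm _ _⟩ e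

/-- `mcount G g h` is the number of edges of `G` strictly closer to `g` than to `h`. -/
noncomputable def mcount {V : Type*} (G : SimpleGraph V) (g h : V) : ℕ :=
  {e ∈ G.edgeSet | evdist G g e < evdist G h e}.ncard

/-- `m0count G g h` is the number of edges of `G`, other than `s(g,h)` itself, that are
equidistant from `g` and from `h`. -/
noncomputable def m0count {V : Type*} (G : SimpleGraph V) (g h : V) : ℕ :=
  {e ∈ G.edgeSet | e ≠ s(g, h) ∧ evdist G g e = evdist G h e}.ncard

/-- `ncount G g h` is the number of vertices of `G` strictly closer to `g` than to `h`. -/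
noncomputable def ncount {V : Type*} (G : SimpleGraph V) (g h : V) : ℕ :=
  {w : V | G.dist w g < G.dist w h}.ncard

/-- Edge quasi-λ-distance-balanced. -/
def IsEQDB {V : Type*} (G : SimpleGraph V) (lam : ℚ) : Prop :=
  ∀ g h : V, G.Adj g h →
    (mcount G g h : ℚ) = lam * mcount G h g ∨ (mcount G h g : ℚ) = lam * mcount G g h

/-- Quasi-λ-distance-balanced. -/
def IsQDB {V : Type*} (G : SimpleGraph V) (lam : ℚ) : Prop :=
  ∀ g h : V, G.Adj g h →
    (ncount G g h : ℚ) = lam * ncount G h g ∨ (ncount G h g : ℚ) = lam * ncount G g h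

/-- The lexicographic product `A[B]` of two simple graphs. -/
def lexProd {α β : Type*} (G : SimpleGraph α) (H : SimpleGraph β) : SimpleGraph (α × β) where
  Adj p q := G.Adj p.1 q.1 ∨ (p.1 = q.1 ∧ H.Adj p.2 q.2)
  symm := ⟨by rintro p q (h | ⟨h1, h2⟩); exacts [Or.inl h.symm, Or.inr ⟨h1.symm, h2.symm⟩]⟩
  loopless := ⟨by rintro p (h | ⟨h1, h2⟩); exacts [G.loopless.irrefl _ h, H.loopless.irrefl _ h2]⟩

section LexProd

variable {α β : Type*} {G : SimpleGraph α} {H : SimpleGraph β}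

theorem evdist_mk {V : Type*} (G : SimpleGraph V) (g u v : V) :
    evdist G g s(u, v) = min (G.dist g u) (G.dist g v) := rfl

theorem exists_lexProd_walk {a c : α} (w : G.Walk a c) (hw : 0 < w.length) (b x : β) :
    ∃ w' : (lexProd G H).Walk (a, b) (c, x), w'.length = w.length := by
  induction w generalizing b with
  | nil => simp at hw
  | @cons u v t h p ih =>
    rcases Nat.eq_zero_or_pos p.length with h0 | h0
    · obtain rfl := Walk.eq_of_length_eq_zero h0
      have hadj : (lexProd G H).Adj (u, b) (v, x) := Or.inl h
      exact ⟨hadj.toWalk, by simp [h0]⟩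
    · obtain ⟨q, hq⟩ := ih h0 x
      have hadj : (lexProd G H).Adj (u, b) (v, x) := Or.inl h
      exact ⟨Walk.cons hadj q, by simp [hq]⟩

theorem dist_fst_le_length (hG : G.Connected) {p q : α × β} (w : (lexProd G H).Walk p q) :
    G.dist p.1 q.1 ≤ w.length := by
  induction w with
  | nil => simp
  | @cons u v t h p ih =>
    rw [Walk.length_cons]
    rcases h with h | ⟨h, -⟩
    · have h1 := hG.dist_triangle (u := u.1) (v := v.1) (w := t.1)
      have h2 := dist_eq_one_iff_adj.2 h
      omega
    · rw [h]; omega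

theorem lexProd_dist_of_ne (hG : G.Connected) {a c : α} (hac : a ≠ c) (b x : β) :
    (lexProd G H).dist (a, b) (c, x) = G.dist a c := by
  obtain ⟨w, hw⟩ := hG.exists_walk_length_eq_dist a c
  have hpos : 0 < w.length := hw ▸ hG.pos_dist_of_ne hac
  obtain ⟨w', hw'⟩ := exists_lexProd_walk (H := H) w hpos b x
  apply le_antisymm
  · rw [← hw, ← hw']
    exact dist_le w'
  · obtain ⟨q, hq⟩ := w'.reachable.exists_walk_length_eq_dist
    rw [← hq]
    exact dist_fst_le_length hG q

open Classical in
theorem lexProd_dist_fiber {a a' : α} (ha : G.Adj a a') (b x : β) :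
    (lexProd G H).dist (a, b) (a, x) = if b = x then 0 else if H.Adj b x then 1 else 2 := by
  obtain ⟨w, hw⟩ := exists_lexProd_walk (H := H) (Walk.cons ha ha.symm.toWalk) (by simp) b x
  have hle : (lexProd G H).dist (a, b) (a, x) ≤ 2 := by simpa [hw] using dist_le w
  have h1 : (lexProd G H).dist (a, b) (a, x) = 1 ↔ H.Adj b x := by
    rw [dist_eq_one_iff_adj]
    simp [lexProd]
  have h0 := w.reachable.dist_eq_zero_iff
  simp only [Prod.mk.injEq, true_and] at h0
  split_ifs <;> grind

/-- The edges of `H` incident to `b`. -/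
def incidentEdges (H : SimpleGraph β) (b : β) : Set (Sym2 β) := {e ∈ H.edgeSet | b ∈ e}

/-- The edges of `H` having no endpoint in the closed neighbourhood of `b`. -/
def farEdges (H : SimpleGraph β) (b : β) : Set (Sym2 β) :=
  {e ∈ H.edgeSet | ∀ x ∈ e, b ≠ x ∧ ¬ H.Adj b x}

/-- The unordered pairs of vertices lying over `a`. -/
def fiberPairs (β : Type*) (a : α) : Set (Sym2 (α × β)) := {e | ∀ p ∈ e, p.1 = a}

theorem mk_mem_fiberPairs {a : α} {p q : α × β} :
    s(p, q) ∈ fiberPairs β a ↔ p.1 = a ∧ q.1 = a := by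
  change (∀ r ∈ s(p, q), r.1 = a) ↔ _
  rw [Sym2.ball]

/-- The edges of `G` strictly closer to `g` than to `h`. -/
def closerEdges {V : Type*} (G : SimpleGraph V) (g h : V) : Set (Sym2 V) :=
  {e ∈ G.edgeSet | evdist G g e < evdist G h e}

theorem evdist_map_mk_of_ne (hG : G.Connected) {a c : α} (hac : a ≠ c) (b : β) (e : Sym2 β) :
    evdist (lexProd G H) (a, b) (e.map (Prod.mk c)) = G.dist a c := by
  induction e with | _ x y
  simp [evdist_mk, lexProd_dist_of_ne hG hac]

theorem evdist_map_mk_eq_zero {a a' : α} (ha : G.Adj a a') (b : β) (e : Sym2 β) :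
    evdist (lexProd G H) (a, b) (e.map (Prod.mk a)) = 0 ↔ b ∈ e := by
  classical
  induction e with | _ x y
  simp only [Sym2.map_mk, evdist_mk, lexProd_dist_fiber ha, Sym2.mem_iff]
  grind

theorem one_lt_evdist_map_mk {a a' : α} (ha : G.Adj a a') (b : β) (e : Sym2 β) :
    1 < evdist (lexProd G H) (a, b) (e.map (Prod.mk a)) ↔ ∀ x ∈ e, b ≠ x ∧ ¬ H.Adj b x := by
  classical
  induction e with | _ x y
  simp only [Sym2.map_mk, evdist_mk, lexProd_dist_fiber ha, Sym2.mem_iff]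
  grind

theorem evdist_map_mk_le_two {a a' : α} (ha : G.Adj a a') (b : β) (e : Sym2 β) :
    evdist (lexProd G H) (a, b) (e.map (Prod.mk a)) ≤ 2 := by
  classical
  induction e with | _ x y
  simp only [Sym2.map_mk, evdist_mk, lexProd_dist_fiber ha]
  grind

/-- Counting the edges of the fiber over `c` amounts to counting edges of `H`. -/
theorem ncard_closerEdges_inter_fiberPairs (c : α) (g h : α × β) :
    (closerEdges (lexProd G H) g h ∩ fiberPairs β c).ncard =
      {e ∈ H.edgeSet | evdist (lexProd G H) g (e.map (Prod.mk c)) <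
        evdist (lexProd G H) h (e.map (Prod.mk c))}.ncard := by
  refine Eq.trans ?_
    (Set.ncard_image_of_injective _ (Sym2.map.injective (Prod.mk_right_injective c)))
  congr 1
  ext e
  induction e with | _ p q
  obtain ⟨p1, p2⟩ := p
  obtain ⟨q1, q2⟩ := q
  constructor
  · rintro ⟨⟨h1, h2⟩, h3⟩
    obtain rfl : p1 = c := h3 (p1, p2) (by simp)
    obtain rfl : q1 = p1 := h3 (q1, q2) (by simp)
    refine ⟨s(p2, q2), ⟨?_, h2⟩, rfl⟩
    rw [mem_edgeSet] at h1 ⊢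
    rcases h1 with h1 | h1
    · exact (G.loopless.irrefl _ h1).elim
    · exact h1.2
  · rintro ⟨e, ⟨h1, h2⟩, h3⟩
    rw [← h3]
    induction e with | _ x y
    refine ⟨⟨Or.inr ⟨rfl, h1⟩, h2⟩, mk_mem_fiberPairs.2 ⟨rfl, rfl⟩⟩

theorem ncard_closerEdges_inter_left (hG : G.Connected) {a a' : α} (ha : G.Adj a a') (b b' : β) :
    (closerEdges (lexProd G H) (a, b) (a', b') ∩ fiberPairs β a).ncard =
      (incidentEdges H b).ncard := by
  rw [ncard_closerEdges_inter_fiberPairs]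
  congr 1
  ext e
  refine and_congr_right fun _ => ?_
  rw [evdist_map_mk_of_ne hG ha.ne', dist_eq_one_iff_adj.2 ha.symm, Nat.lt_one_iff,
    evdist_map_mk_eq_zero ha]

theorem ncard_closerEdges_inter_right (hG : G.Connected) {a a' : α} (ha : G.Adj a a')
    (b b' : β) :
    (closerEdges (lexProd G H) (a, b) (a', b') ∩ fiberPairs β a').ncard =
      (farEdges H b').ncard := by
  rw [ncard_closerEdges_inter_fiberPairs]
  congr 1
  ext e
  refine and_congr_right fun _ => ?_
  rw [evdist_map_mk_of_ne hG ha.ne, dist_eq_one_iff_adj.2 ha, one_lt_evdist_map_mk ha.symm]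

/-- Permuting each fiber preserves the distance from `(a, b)` to any edge that does not lie over
`a`. -/
theorem evdist_map_perm (hG : G.Connected) {a a' : α} (ha : G.Adj a a') (b : β)
    (π : α → Equiv.Perm β) {e : Sym2 (α × β)} (he : e ∈ (lexProd G H).edgeSet)
    (hea : e ∉ fiberPairs β a) :
    evdist (lexProd G H) (a, π a b) (e.map fun p => (p.1, π p.1 p.2)) =
      evdist (lexProd G H) (a, b) e := by
  classical
  induction e with | _ p q
  obtain ⟨c, x⟩ := p
  obtain ⟨d, y⟩ := q
  simp only [Sym2.map_mk, evdist_mk]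
  have hcd : a ≠ c ∨ a ≠ d := by
    by_contra! hcd
    exact hea (mk_mem_fiberPairs.2 ⟨hcd.1.symm, hcd.2.symm⟩)
  by_cases hc : a = c
  · subst hc
    have hd : a ≠ d := by simpa using hcd
    have had : G.Adj a d := by
      rcases he with h | h
      · exact h
      · exact (hd h.1).elim
    simp only [lexProd_dist_of_ne hG hd, lexProd_dist_fiber ha, dist_eq_one_iff_adj.2 had,
      (π a).injective.eq_iff]
    grind
  · by_cases hd : a = d
    · subst hd
      have had : G.Adj c a := by
        rcases he with h | h
        · exact h
        · exact (hc h.1.symm).elim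
      simp only [lexProd_dist_of_ne hG hc, lexProd_dist_fiber ha,
        dist_eq_one_iff_adj.2 had.symm, (π a).injective.eq_iff]
      grind
    · simp only [lexProd_dist_of_ne hG hc, lexProd_dist_of_ne hG hd]

theorem ncard_closerEdges_diff_le [Finite α] [Finite β] (hG : G.Connected) {a a' c c' : α}
    (ha : G.Adj a c) (ha' : G.Adj a' c') (b b' : β) (π : α → Equiv.Perm β)
    (hπ : ∀ d, d ≠ a → d ≠ a' → π d = 1) :
    (closerEdges (lexProd G H) (a, b) (a', b') \ (fiberPairs β a ∪ fiberPairs β a')).ncard ≤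
      (closerEdges (lexProd G H) (a, π a b) (a', π a' b') \
        (fiberPairs β a ∪ fiberPairs β a')).ncard := by
  have hinj : Function.Injective fun p : α × β => (p.1, π p.1 p.2) := by
    rintro ⟨p1, p2⟩ ⟨q1, q2⟩ h
    simp only [Prod.mk.injEq] at h
    obtain ⟨rfl, h⟩ := h
    simpa using h
  refine Set.ncard_le_ncard_of_injOn (Sym2.map fun p => (p.1, π p.1 p.2)) ?_
    (Sym2.map.injective hinj).injOn (Set.toFinite _)
  rintro e ⟨⟨he, hlt⟩, hf⟩
  rw [Set.mem_union, not_or] at hf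
  refine ⟨⟨?_, ?_⟩, ?_⟩
  · induction e with | _ p q
    rcases he with h | ⟨h, h'⟩
    · exact Or.inl h
    · obtain ⟨d, x⟩ := p
      obtain ⟨d', y⟩ := q
      obtain rfl : d = d' := h
      have h1 : d ≠ a := fun h1 => hf.1 (mk_mem_fiberPairs.2 ⟨h1, h1⟩)
      have h2 : d ≠ a' := fun h2 => hf.2 (mk_mem_fiberPairs.2 ⟨h2, h2⟩)
      exact Or.inr ⟨rfl, by simpa [hπ d h1 h2] using h'⟩
  · rw [evdist_map_perm hG ha b π he hf.1, evdist_map_perm hG ha' b' π he hf.2]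
    exact hlt
  · simpa [fiberPairs] using hf

theorem mcount_of_adj [Finite α] [Finite β] (hG : G.Connected) {a a' : α} (ha : G.Adj a a') :
    ∃ C : ℕ, ∀ b b' : β, mcount (lexProd G H) (a, b) (a', b') =
      (incidentEdges H b).ncard + (farEdges H b').ncard + C := by
  classical
  have hle : ∀ b b' b₁ b₁' : β,
      (closerEdges (lexProd G H) (a, b) (a', b') \ (fiberPairs β a ∪ fiberPairs β a')).ncard ≤
      (closerEdges (lexProd G H) (a, b₁) (a', b₁') \
        (fiberPairs β a ∪ fiberPairs β a')).ncard := by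
    intro b b' b₁ b₁'
    have := ncard_closerEdges_diff_le (H := H) hG ha ha.symm b b'
      (fun d => if d = a then Equiv.swap b b₁ else if d = a' then Equiv.swap b' b₁' else 1)
      (fun d h1 h2 => by simp [h1, h2])
    simpa [ha.ne'] using this
  have hdisj : Disjoint (fiberPairs β a) (fiberPairs β a') := by
    rw [Set.disjoint_left]
    intro e h1 h2
    induction e with | _ p q
    exact ha.ne ((h1 p (by simp)).symm.trans (h2 p (by simp)))
  rcases isEmpty_or_nonempty β with hβ | ⟨⟨b₀⟩⟩
  · exact ⟨0, fun b => hβ.elim b⟩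
  refine ⟨(closerEdges (lexProd G H) (a, b₀) (a', b₀) \
    (fiberPairs β a ∪ fiberPairs β a')).ncard, fun b b' => ?_⟩
  rw [le_antisymm (hle b₀ b₀ b b') (hle b b' b₀ b₀), ← ncard_closerEdges_inter_left hG ha b b',
    ← ncard_closerEdges_inter_right hG ha b b', ← Set.ncard_union_eq
      (hdisj.mono Set.inter_subset_right Set.inter_subset_right) (Set.toFinite _) (Set.toFinite _),
    ← Set.inter_union_distrib_left, Set.ncard_inter_add_ncard_sdiff_eq_ncard _ _ (Set.toFinite _)]
  rfl

theorem mcount_fiber_le [Finite α] [Finite β] (hG : G.Connected) {a a' : α} (ha : G.Adj a a')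
    {b b' : β} (hb : H.Adj b b')
    (hi : (incidentEdges H b).ncard = (incidentEdges H b').ncard)
    (hf : (farEdges H b).ncard = (farEdges H b').ncard) :
    mcount (lexProd G H) (a, b) (a, b') ≤ mcount (lexProd G H) (a, b') (a, b) := by
  classical
  have key : ∀ {b b' : β}, H.Adj b b' →
      (closerEdges (lexProd G H) (a, b) (a, b') ∩ fiberPairs β a).ncard =
        (incidentEdges H b \ incidentEdges H b').ncard + (farEdges H b' \ farEdges H b).ncard := by
    intro b b' hb
    rw [ncard_closerEdges_inter_fiberPairs,
      ← Set.ncard_union_eq _ (Set.toFinite _) (Set.toFinite _)]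
    · congr 1
      ext e
      have h1 := evdist_map_mk_eq_zero (H := H) ha b e
      have h2 := evdist_map_mk_eq_zero (H := H) ha b' e
      have h3 := one_lt_evdist_map_mk (H := H) ha b e
      have h4 := one_lt_evdist_map_mk (H := H) ha b' e
      have h5 := evdist_map_mk_le_two (H := H) ha b e
      have h6 := evdist_map_mk_le_two (H := H) ha b' e
      have h7 : b ∈ e → ¬ ∀ x ∈ e, b' ≠ x ∧ ¬ H.Adj b' x := fun h h' => (h' b h).2 hb.symm
      simp only [incidentEdges, farEdges, Set.mem_union, Set.mem_sdiff, Set.mem_ofPred_eq,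
        ← h1, ← h2, ← h3, ← h4] at h7 ⊢
      by_cases he : e ∈ H.edgeSet
      · simp only [he, true_and]
        omega
      · simp [he]
    · rw [Set.disjoint_left]
      rintro e ⟨h1, -⟩ ⟨h2, -⟩
      exact (h2.2 b h1.2).2 hb.symm
  have hrest := ncard_closerEdges_diff_le (H := H) hG ha ha b b'
    (fun d => if d = a then Equiv.swap b b' else 1) (fun d h1 _ => by simp [h1])
  simp only [if_true, Equiv.swap_apply_left, Equiv.swap_apply_right, Set.union_self] at hrest
  have e1 := Set.ncard_inter_add_ncard_sdiff_eq_ncard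
    (closerEdges (lexProd G H) (a, b) (a, b')) (fiberPairs β a) (Set.toFinite _)
  have e2 := Set.ncard_inter_add_ncard_sdiff_eq_ncard
    (closerEdges (lexProd G H) (a, b') (a, b)) (fiberPairs β a) (Set.toFinite _)
  have i1 := Set.ncard_inter_add_ncard_sdiff_eq_ncard
    (incidentEdges H b) (incidentEdges H b') (Set.toFinite _)
  have i2 := Set.ncard_inter_add_ncard_sdiff_eq_ncard
    (incidentEdges H b') (incidentEdges H b) (Set.toFinite _)
  have f1 := Set.ncard_inter_add_ncard_sdiff_eq_ncard
    (farEdges H b) (farEdges H b') (Set.toFinite _)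
  have f2 := Set.ncard_inter_add_ncard_sdiff_eq_ncard
    (farEdges H b') (farEdges H b) (Set.toFinite _)
  rw [Set.inter_comm] at i2 f2
  rw [key hb] at e1
  rw [key hb.symm] at e2
  change (closerEdges (lexProd G H) (a, b) (a, b')).ncard ≤
    (closerEdges (lexProd G H) (a, b') (a, b)).ncard
  omega

theorem mcount_fiber_pos [Finite α] [Finite β] (hG : G.Connected) {a a' : α} (ha : G.Adj a a')
    {b b' : β} (hb : b ≠ b') : 0 < mcount (lexProd G H) (a, b) (a, b') := by
  classical
  rw [mcount, Set.ncard_pos (Set.toFinite _)]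
  refine ⟨s((a, b), (a', b)), Or.inl ha, ?_⟩
  rw [evdist_mk, evdist_mk, lexProd_dist_of_ne hG ha.ne, lexProd_dist_of_ne hG ha.ne,
    lexProd_dist_fiber ha, lexProd_dist_fiber ha, dist_eq_one_iff_adj.2 ha]
  simp only [hb.symm, if_true, if_false]
  split_ifs <;> simp

theorem eq_of_quasi_balanced {ι : Type*} (u v : ι → ℕ) {C C' : ℕ} (hC : C' < C) {lam : ℚ}
    (hlam : 1 < lam)
    (h : ∀ b b', ((u b + v b' + C : ℕ) : ℚ) = lam * (u b' + v b + C' : ℕ) ∨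
      ((u b' + v b + C' : ℕ) : ℚ) = lam * (u b + v b' + C : ℕ)) (b b' : ι) :
    u b = u b' ∧ v b = v b' := by
  have hC' : (C' : ℚ) < C := by exact_mod_cast hC
  have hC0 : (0 : ℚ) ≤ C' := by positivity
  have diag : ∀ b, (u b + v b + C : ℚ) = lam * (u b + v b + C') := by
    intro b
    have hu : (0 : ℚ) ≤ u b := by positivity
    have hv : (0 : ℚ) ≤ v b := by positivity
    rcases h b b with h | h <;> push_cast at h
    · exact h
    · nlinarith
  have hsum : (u b + v b : ℚ) = u b' + v b' := by
    have h1 := diag b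
    have h2 := diag b'
    have : (lam - 1) * ((u b + v b : ℚ) - (u b' + v b')) = 0 := by linear_combination h2 - h1
    rcases mul_eq_zero.1 this with h | h <;> linarith
  have hmain : (u b : ℚ) = u b' := by
    have d := diag b
    have hu : (0 : ℚ) ≤ u b := by positivity
    have hv : (0 : ℚ) ≤ v b := by positivity
    have hu' : (0 : ℚ) ≤ u b' := by positivity
    have hv' : (0 : ℚ) ≤ v b' := by positivity
    have fin : (1 + lam) * ((u b : ℚ) - u b') = 0 → (u b : ℚ) = u b' := by
      intro h
      rcases mul_eq_zero.1 h with h | h <;> linarith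
    have hvb : (v b' : ℚ) = u b + v b - u b' := by linarith
    rcases h b b' with h1 | h1 <;> push_cast at h1 <;> rw [hvb] at h1
    · exact fin (by linear_combination h1 - d)
    · rcases h b' b with h2 | h2 <;> push_cast at h2 <;> rw [hvb] at h2
      · exact fin (by linear_combination d - h2)
      · nlinarith
  exact ⟨by exact_mod_cast hmain, by exact_mod_cast (by linarith : (v b : ℚ) = v b')⟩

theorem not_isEQDB_of_mcount_eq {V : Type*} {G : SimpleGraph V} {g h : V} (hgh : G.Adj g h)
    (heq : mcount G g h = mcount G h g) (hpos : 0 < mcount G g h) {lam : ℚ} (hlam : 1 < lam) :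
    ¬ IsEQDB G lam := by
  intro H
  have hp : (0 : ℚ) < mcount G g h := by exact_mod_cast hpos
  rcases H g h hgh with h | h <;> rw [← heq] at h <;> nlinarith

theorem lexProd_not_colorable_two {a a' : α} (ha : G.Adj a a') {b b' : β} (hb : H.Adj b b') :
    ¬ (lexProd G H).Colorable 2 := by
  rintro ⟨f⟩
  have h1 : f (a, b) ≠ f (a, b') := f.valid (Or.inr ⟨rfl, hb⟩)
  have h2 : f (a, b) ≠ f (a', b) := f.valid (Or.inl ha)
  have h3 : f (a, b') ≠ f (a', b) := f.valid (Or.inl ha)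
  omega

end LexProd

/-- If `A` is a finite connected graph with at least one edge, `B` is a finite
graph with at least one edge, and `λ > 1` is rational, then the lexicographic product `A[B]` is
not edge quasi-λ-distance-balanced; in particular it is not bipartite. -/
theorem lexProd_not_eqdb {α β : Type*} [Fintype α] [Fintype β]
    (G : SimpleGraph α) (H : SimpleGraph β) (hG : G.Connected)
    (hGe : G.edgeSet.Nonempty) (hHe : H.edgeSet.Nonempty)
    (lam : ℚ) (hlam : 1 < lam) :
    ¬ IsEQDB (lexProd G H) lam ∧ ¬ (lexProd G H).Colorable 2 := by
  obtain ⟨⟨a, a'⟩, ha⟩ := hGe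
  obtain ⟨⟨b, b'⟩, hb⟩ := hHe
  change G.Adj a a' at ha
  change H.Adj b b' at hb
  refine ⟨fun hE => ?_, lexProd_not_colorable_two ha hb⟩
  obtain ⟨C, hC⟩ := mcount_of_adj (H := H) hG ha
  obtain ⟨C', hC'⟩ := mcount_of_adj (H := H) hG ha.symm
  have bal : ∀ x y : β, _ := fun x y => hE (a, x) (a', y) (Or.inl ha)
  simp only [hC, hC'] at bal
  have hreg : (incidentEdges H b).ncard = (incidentEdges H b').ncard ∧
      (farEdges H b).ncard = (farEdges H b').ncard := by
    rcases lt_trichotomy C C' with h | rfl | h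
    · exact eq_of_quasi_balanced (fun x => (incidentEdges H x).ncard)
        (fun x => (farEdges H x).ncard) h hlam (fun x y => (bal y x).symm) b b'
    · have hpos : 0 < (incidentEdges H b).ncard :=
        (Set.ncard_pos (Set.toFinite _)).2 ⟨s(b, b'), hb, by simp⟩
      refine (not_isEQDB_of_mcount_eq (g := (a, b)) (h := (a', b)) (Or.inl ha) ?_ ?_ hlam hE).elim
      · rw [hC, hC']
      · rw [hC]
        omega
    · exact eq_of_quasi_balanced (fun x => (incidentEdges H x).ncard)
        (fun x => (farEdges H x).ncard) h hlam bal b b'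
  exact not_isEQDB_of_mcount_eq (g := (a, b)) (h := (a, b')) (Or.inr ⟨rfl, hb⟩)
    (le_antisymm (mcount_fiber_le hG ha hb hreg.1 hreg.2)
      (mcount_fiber_le hG ha hb.symm hreg.1.symm hreg.2.symm))
    (mcount_fiber_pos hG ha hb.ne) hlam hE
end

section
/- Let m ≥ 3 and let O be the graph obtained from the complete bipartite graph K_{m,m} by replacing each edge with a square: the vertex set of O is V(K_{m,m}) ⊔ (E(K_{m,m}) × {0,1}), with an original vertex v adjacent to (e,i) iff v is an endpoint of e, and no other adjacencies. Then for every edge f = g y of O, where g is an original vertex and y = (e,i) is a new vertex, m_g(f) = 2m² − 1 and m_y(f) = 4m − 3. -/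
open SimpleGraph

/-- The graph `O(G)` obtained from `G` by replacing each edge with a square: vertices are
`V(G) ⊕ (E(G) × Fin 2)`, an original vertex `v` is adjacent to `(e, i)` iff `v` is an endpoint
of `e`, and there are no other adjacencies. -/
def squareReplace {V : Type*} (G : SimpleGraph V) : SimpleGraph (V ⊕ (G.edgeSet × Fin 2)) where
  Adj x y :=
    match x, y with
    | Sum.inl v, Sum.inr (e, _) => v ∈ (e : Sym2 V)
    | Sum.inr (e, _), Sum.inl v => v ∈ (e : Sym2 V)
    | _, _ => False
  symm := ⟨by rintro (v | ⟨e, i⟩) (w | ⟨f, j⟩) h <;> exact h⟩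
  loopless := ⟨by rintro (v | ⟨e, i⟩) h <;> exact h⟩

namespace SimpleGraph

variable {V W : Type*} {G : SimpleGraph V} {H : SimpleGraph W}

/-- A `1`-Lipschitz function vanishing at `g` that decreases along some edge wherever it is nonzero,
and vanishes only at `g`, is the distance from `g`. -/
theorem dist_eq_of_potential {g : V} (f : V → ℕ) (h0 : f g = 0)
    (hzero : ∀ v, f v = 0 → v = g) (hlip : ∀ u v, G.Adj u v → f v ≤ f u + 1)
    (hdesc : ∀ v, f v ≠ 0 → ∃ u, G.Adj u v ∧ f v = f u + 1) (v : V) :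
    G.dist g v = f v := by
  have hupper : ∀ n v, f v = n → ∃ p : G.Walk g v, p.length = n := by
    intro n
    induction n with
    | zero =>
      intro v hv
      obtain rfl := hzero v hv
      exact ⟨.nil, rfl⟩
    | succ n ih =>
      intro v hv
      obtain ⟨u, hu, hfu⟩ := hdesc v (by omega)
      obtain ⟨p, hp⟩ := ih u (by omega)
      exact ⟨p.concat hu, by simp [hp]⟩
  have hlower : ∀ {u v : V} (p : G.Walk u v), f v ≤ f u + p.length := by
    intro u v p
    induction p with
    | nil => simp
    | cons h p ih =>
      have := hlip _ _ h
      simp only [Walk.length_cons]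
      omega
  obtain ⟨p, hp⟩ := hupper _ v rfl
  have hle := dist_le p
  obtain ⟨q, hq⟩ := p.reachable.exists_walk_length_eq_dist
  have := hlower q
  omega

theorem Iso.dist_map_eq (φ : G ≃g H) (u v : V) : H.dist (φ u) (φ v) = G.dist u v := by
  have key : ∀ {V W : Type _} {G : SimpleGraph V} {H : SimpleGraph W} (φ : G ≃g H) (u v : V),
      G.Reachable u v → H.dist (φ u) (φ v) ≤ G.dist u v := by
    intro V W G H φ u v h
    obtain ⟨q, hq⟩ := h.exists_walk_length_eq_dist
    rw [← hq, ← Walk.length_map φ.toHom q]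
    exact dist_le _
  by_cases h : G.Reachable u v
  · refine le_antisymm (key φ u v h) ?_
    have h' := φ.reachable_iff.mpr h
    obtain ⟨q, hq⟩ := h'.exists_walk_length_eq_dist
    rw [← hq, ← Walk.length_map φ.symm.toHom q]
    refine le_of_eq_of_le ?_ (dist_le _)
    congr 1 <;> exact (φ.symm_apply_apply _).symm
  · rw [dist_eq_zero_of_not_reachable h,
      dist_eq_zero_of_not_reachable (fun h' => h (φ.reachable_iff.mp h'))]

theorem Iso.evdist_map_eq (φ : G ≃g H) (g : V) (e : Sym2 V) :
    evdist H (φ g) (e.map φ) = evdist G g e := by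
  induction e with
  | _ u v => simp [evdist, φ.dist_map_eq]

theorem Iso.mcount_map_eq (φ : G ≃g H) (g h : V) : mcount H (φ g) (φ h) = mcount G g h := by
  unfold mcount
  rw [← Set.ncard_image_of_injective _ (Sym2.map.injective φ.injective)]
  congr 1
  ext e
  constructor
  · rintro ⟨he, hlt⟩
    refine ⟨e.map φ.symm, ?_, ?_⟩
    · have hmap : (e.map φ.symm).map φ = e := by simp [Sym2.map_map]
      refine ⟨?_, ?_⟩
      · induction e with
        | _ u v => simpa [φ.symm.map_adj_iff] using he
      · rw [← φ.evdist_map_eq, ← φ.evdist_map_eq, hmap]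
        exact hlt
    · simp [Sym2.map_map]
  · rintro ⟨e, ⟨he, hlt⟩, rfl⟩
    refine ⟨?_, by simpa only [φ.evdist_map_eq] using hlt⟩
    induction e with
    | _ u v => simpa [φ.map_adj_iff] using he

end SimpleGraph

/-- A coordinate model of `squareReplace (completeBipartiteGraph (Fin m) (Fin m))`: the triple
`(x, z, j)` is the `j`-th new vertex joining `x` on the left to `z` on the right. -/
def bipartiteSquare (m : ℕ) : SimpleGraph ((Fin m ⊕ Fin m) ⊕ (Fin m × Fin m × Fin 2)) where
  Adj u v :=
    match u, v with
    | Sum.inl (Sum.inl x), Sum.inr p => x = p.1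
    | Sum.inl (Sum.inr z), Sum.inr p => z = p.2.1
    | Sum.inr p, Sum.inl (Sum.inl x) => x = p.1
    | Sum.inr p, Sum.inl (Sum.inr z) => z = p.2.1
    | _, _ => False
  symm := ⟨by rintro ((x | z) | p) ((x' | z') | p') h <;> exact h⟩
  loopless := ⟨by rintro ((x | z) | p) h <;> exact h⟩

namespace bipartiteSquare

variable {m : ℕ}

/-- The edge joining a new vertex to its left end. -/
abbrev leftEdge (p : Fin m × Fin m × Fin 2) :
    Sym2 ((Fin m ⊕ Fin m) ⊕ (Fin m × Fin m × Fin 2)) :=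
  s(Sum.inl (Sum.inl p.1), Sum.inr p)

/-- The edge joining a new vertex to its right end. -/
abbrev rightEdge (p : Fin m × Fin m × Fin 2) :
    Sym2 ((Fin m ⊕ Fin m) ⊕ (Fin m × Fin m × Fin 2)) :=
  s(Sum.inl (Sum.inr p.2.1), Sum.inr p)

theorem leftEdge_injective : Function.Injective (leftEdge (m := m)) := by
  intro p q h
  exact (by simpa [leftEdge] using h : _ ∧ p = q).2

theorem rightEdge_injective : Function.Injective (rightEdge (m := m)) := by
  intro p q h
  exact (by simpa [rightEdge] using h : _ ∧ p = q).2

theorem mem_edgeSet_iff (e : Sym2 ((Fin m ⊕ Fin m) ⊕ (Fin m × Fin m × Fin 2))) :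
    e ∈ (bipartiteSquare m).edgeSet ↔ (∃ p, leftEdge p = e) ∨ ∃ p, rightEdge p = e := by
  constructor
  · induction e with
    | _ u v =>
      rcases u with (x | z) | p <;> rcases v with (x' | z') | p' <;> intro h <;>
        first
        | exact absurd h id
        | (obtain rfl : _ = _ := h
           first
           | exact Or.inl ⟨_, rfl⟩
           | exact Or.inl ⟨_, Sym2.eq_swap⟩
           | exact Or.inr ⟨_, rfl⟩
           | exact Or.inr ⟨_, Sym2.eq_swap⟩)
  · rintro (⟨p, rfl⟩ | ⟨p, rfl⟩)
    · exact (rfl : p.1 = p.1)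
    · exact (rfl : p.2.1 = p.2.1)

theorem mcount_eq (g h : (Fin m ⊕ Fin m) ⊕ (Fin m × Fin m × Fin 2))
    (A B : Finset (Fin m × Fin m × Fin 2))
    (hA : ∀ p, p ∈ A ↔
      evdist (bipartiteSquare m) g (leftEdge p) < evdist (bipartiteSquare m) h (leftEdge p))
    (hB : ∀ p, p ∈ B ↔
      evdist (bipartiteSquare m) g (rightEdge p) < evdist (bipartiteSquare m) h (rightEdge p)) :
    mcount (bipartiteSquare m) g h = A.card + B.card := by
  classical
  have hset : {e ∈ (bipartiteSquare m).edgeSet |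
      evdist (bipartiteSquare m) g e < evdist (bipartiteSquare m) h e} =
      ((A.image leftEdge ∪ B.image rightEdge : Finset _) : Set _) := by
    ext e
    simp only [Set.mem_ofPred_eq, mem_edgeSet_iff, Finset.coe_union, Finset.coe_image,
      Set.mem_union, Set.mem_image, Finset.mem_coe]
    constructor
    · rintro ⟨⟨p, rfl⟩ | ⟨p, rfl⟩, hlt⟩
      · exact Or.inl ⟨p, (hA p).mpr hlt, rfl⟩
      · exact Or.inr ⟨p, (hB p).mpr hlt, rfl⟩
    · rintro (⟨p, hp, rfl⟩ | ⟨p, hp, rfl⟩)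
      · exact ⟨Or.inl ⟨p, rfl⟩, (hA p).mp hp⟩
      · exact ⟨Or.inr ⟨p, rfl⟩, (hB p).mp hp⟩
  have hdisj : Disjoint (A.image leftEdge) (B.image rightEdge) := by
    rw [Finset.disjoint_left]
    intro e he he'
    obtain ⟨p, -, rfl⟩ := Finset.mem_image.mp he
    obtain ⟨q, -, hq⟩ := Finset.mem_image.mp he'
    simp [leftEdge, rightEdge] at hq
  rw [mcount, hset, Set.ncard_coe_finset, Finset.card_union_of_disjoint hdisj,
    Finset.card_image_of_injective _ leftEdge_injective,
    Finset.card_image_of_injective _ rightEdge_injective]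

theorem dist_left (a : Fin m) (v : (Fin m ⊕ Fin m) ⊕ (Fin m × Fin m × Fin 2)) :
    (bipartiteSquare m).dist (Sum.inl (Sum.inl a)) v =
      match v with
      | Sum.inl (Sum.inl x) => if x = a then 0 else 4
      | Sum.inl (Sum.inr _) => 2
      | Sum.inr p => if p.1 = a then 1 else 3 := by
  refine dist_eq_of_potential (g := Sum.inl (Sum.inl a)) (fun v => match v with
      | Sum.inl (Sum.inl x) => if x = a then 0 else 4
      | Sum.inl (Sum.inr _) => 2
      | Sum.inr p => if p.1 = a then 1 else 3) (if_pos rfl) ?_ ?_ ?_ v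
  · rintro ((x | z) | p) h
    · simpa using h
    · simp at h
    · dsimp at h; split_ifs at h
  · rintro ((x | z) | p) ((x' | z') | p') h <;>
      first
      | exact absurd h id
      | (obtain rfl : _ = _ := h
         dsimp
         split_ifs <;> omega)
  · rintro ((x | z) | p) h
    · have hx : x ≠ a := by simpa using h
      exact ⟨Sum.inr (x, a, 0), rfl, by simp [hx]⟩
    · exact ⟨Sum.inr (a, z, 0), rfl, by simp⟩
    · by_cases hp : p.1 = a
      · exact ⟨Sum.inl (Sum.inl a), hp.symm, by simp [hp]⟩
      · exact ⟨Sum.inl (Sum.inr p.2.1), rfl, by simp [hp]⟩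

theorem dist_new (q : Fin m × Fin m × Fin 2) (v : (Fin m ⊕ Fin m) ⊕ (Fin m × Fin m × Fin 2)) :
    (bipartiteSquare m).dist (Sum.inr q) v =
      match v with
      | Sum.inl (Sum.inl x) => if x = q.1 then 1 else 3
      | Sum.inl (Sum.inr z) => if z = q.2.1 then 1 else 3
      | Sum.inr p => if p = q then 0 else if p.1 = q.1 ∨ p.2.1 = q.2.1 then 2 else 4 := by
  refine dist_eq_of_potential (g := Sum.inr q) (fun v => match v with
      | Sum.inl (Sum.inl x) => if x = q.1 then 1 else 3
      | Sum.inl (Sum.inr z) => if z = q.2.1 then 1 else 3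
      | Sum.inr p => if p = q then 0 else if p.1 = q.1 ∨ p.2.1 = q.2.1 then 2 else 4)
    (if_pos rfl) ?_ ?_ ?_ v
  · rintro ((x | z) | p) h <;> dsimp at h <;> split_ifs at h
    simp_all
  · rintro ((x | z) | p) ((x' | z') | p') h <;>
      first
      | exact absurd h id
      | (obtain rfl : _ = _ := h
         dsimp
         split_ifs <;> simp_all)
  · rintro ((x | z) | p) h
    · by_cases hx : x = q.1
      · exact ⟨Sum.inr q, hx, by simp [hx]⟩
      · exact ⟨Sum.inr (x, q.2.1, 0), rfl, by
          have : (x, q.2.1, (0 : Fin 2)) ≠ q := fun h => hx (by rw [← h])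
          simp [hx, this]⟩
    · by_cases hz : z = q.2.1
      · exact ⟨Sum.inr q, hz, by simp [hz]⟩
      · exact ⟨Sum.inr (q.1, z, 0), rfl, by
          have : (q.1, z, (0 : Fin 2)) ≠ q := fun h => hz (by rw [← h])
          simp [hz, this]⟩
    · have hp : p ≠ q := by rintro rfl; simp at h
      by_cases hx : p.1 = q.1
      · exact ⟨Sum.inl (Sum.inl p.1), rfl, by simp [hp, hx]⟩
      · by_cases hz : p.2.1 = q.2.1
        · exact ⟨Sum.inl (Sum.inr p.2.1), rfl, by simp [hp, hz]⟩
        · exact ⟨Sum.inl (Sum.inl p.1), rfl, by simp [hp, hx, hz]⟩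

theorem mcount_left_new (q : Fin m × Fin m × Fin 2) :
    mcount (bipartiteSquare m) (Sum.inl (Sum.inl q.1)) (Sum.inr q) = 2 * m ^ 2 - 1 := by
  rw [mcount_eq _ _ (({q.1} ×ˢ Finset.univ).erase q) (Finset.univ ×ˢ {q.2.1}ᶜ ×ˢ Finset.univ)]
  · rw [Finset.card_erase_of_mem (by simp)]
    obtain ⟨k, rfl⟩ : ∃ k, m = k + 1 := ⟨m - 1, by have := q.1.pos; omega⟩
    simp only [Finset.card_product, Finset.card_singleton, Finset.card_univ, Finset.card_compl,
      Fintype.card_prod, Fintype.card_fin, Nat.add_sub_cancel]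
    have : (k + 1) * (k * 2) + 2 * (k + 1) = 2 * (k + 1) ^ 2 := by ring
    omega
  · intro p
    simp only [evdist, leftEdge, Sym2.lift_mk, dist_left, dist_new, Finset.mem_erase,
      Finset.mem_product, Finset.mem_singleton, Finset.mem_univ]
    split_ifs <;> simp_all
  · intro p
    simp only [evdist, rightEdge, Sym2.lift_mk, dist_left, dist_new, Finset.mem_compl,
      Finset.mem_product, Finset.mem_singleton, Finset.mem_univ]
    split_ifs <;> simp_all

theorem mcount_new_left (q : Fin m × Fin m × Fin 2) :
    mcount (bipartiteSquare m) (Sum.inr q) (Sum.inl (Sum.inl q.1)) = 4 * m - 3 := by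
  rw [mcount_eq _ _ ({q.1}ᶜ ×ˢ {q.2.1} ×ˢ Finset.univ)
    (insert q ({q.1}ᶜ ×ˢ {q.2.1} ×ˢ Finset.univ))]
  · rw [Finset.card_insert_of_notMem (by simp)]
    simp only [Finset.card_product, Finset.card_singleton, Finset.card_univ, Finset.card_compl,
      Fintype.card_fin]
    have := q.1.pos
    omega
  · intro p
    simp only [evdist, leftEdge, Sym2.lift_mk, dist_left, dist_new, Finset.mem_compl,
      Finset.mem_product, Finset.mem_singleton, Finset.mem_univ]
    split_ifs <;> simp_all
  · intro p
    simp only [evdist, rightEdge, Sym2.lift_mk, dist_left, dist_new, Finset.mem_insert,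
      Finset.mem_compl, Finset.mem_product, Finset.mem_singleton, Finset.mem_univ]
    split_ifs <;> simp_all

/-- The edge of `completeBipartiteGraph` joining the images of `x` and `z` under an
automorphism. -/
def mapEdge (σ : completeBipartiteGraph (Fin m) (Fin m) ≃g completeBipartiteGraph (Fin m) (Fin m))
    (x z : Fin m) : (completeBipartiteGraph (Fin m) (Fin m)).edgeSet :=
  ⟨s(σ (Sum.inl x), σ (Sum.inr z)), σ.map_adj_iff.mpr (by simp)⟩

/-- The map on vertices induced by an automorphism of `completeBipartiteGraph`. -/
def toSquareReplace
    (σ : completeBipartiteGraph (Fin m) (Fin m) ≃g completeBipartiteGraph (Fin m) (Fin m)) :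
    (Fin m ⊕ Fin m) ⊕ (Fin m × Fin m × Fin 2) →
      (Fin m ⊕ Fin m) ⊕ ((completeBipartiteGraph (Fin m) (Fin m)).edgeSet × Fin 2) :=
  Sum.map σ fun p => (mapEdge σ p.1 p.2.1, p.2.2)

theorem toSquareReplace_bijective
    (σ : completeBipartiteGraph (Fin m) (Fin m) ≃g completeBipartiteGraph (Fin m) (Fin m)) :
    Function.Bijective (toSquareReplace σ) := by
  refine ⟨σ.injective.sumMap ?_, σ.surjective.sumMap ?_⟩
  · rintro ⟨x, z, j⟩ ⟨x', z', j'⟩ h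
    simpa [mapEdge, Subtype.ext_iff, and_assoc] using h
  · rintro ⟨⟨e, he⟩, j⟩
    induction e with
    | _ u v =>
      obtain ⟨u, rfl⟩ := σ.surjective u
      obtain ⟨v, rfl⟩ := σ.surjective v
      have hadj := σ.map_adj_iff.mp he
      rcases u with x | z <;> rcases v with x' | z'
      · simp at hadj
      · exact ⟨(x, z', j), rfl⟩
      · exact ⟨(x', z, j), by simp [mapEdge, Sym2.eq_swap]⟩
      · simp at hadj

/-- The coordinate model is isomorphic to `squareReplace` of the complete bipartite graph. -/
noncomputable def isoSquareReplace
    (σ : completeBipartiteGraph (Fin m) (Fin m) ≃g completeBipartiteGraph (Fin m) (Fin m)) :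
    bipartiteSquare m ≃g squareReplace (completeBipartiteGraph (Fin m) (Fin m)) where
  toEquiv := Equiv.ofBijective _ (toSquareReplace_bijective σ)
  map_rel_iff' := by
    rintro ((x | z) | p) ((x' | z') | p') <;>
      simp [toSquareReplace, mapEdge, squareReplace, bipartiteSquare]

/-- The two mcounts at an edge of `squareReplace` whose original end is the image of a left
vertex. -/
theorem mcount_squareReplace
    (σ : completeBipartiteGraph (Fin m) (Fin m) ≃g completeBipartiteGraph (Fin m) (Fin m))
    (a : Fin m) (y : (completeBipartiteGraph (Fin m) (Fin m)).edgeSet × Fin 2)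
    (hadj : (squareReplace (completeBipartiteGraph (Fin m) (Fin m))).Adj
      (Sum.inl (σ (Sum.inl a))) (Sum.inr y)) :
    mcount (squareReplace (completeBipartiteGraph (Fin m) (Fin m)))
        (Sum.inl (σ (Sum.inl a))) (Sum.inr y) = 2 * m ^ 2 - 1 ∧
      mcount (squareReplace (completeBipartiteGraph (Fin m) (Fin m)))
        (Sum.inr y) (Sum.inl (σ (Sum.inl a))) = 4 * m - 3 := by
  have hleft : isoSquareReplace σ (Sum.inl (Sum.inl a)) = Sum.inl (σ (Sum.inl a)) := rfl
  obtain ⟨q, hq⟩ : ∃ q, isoSquareReplace σ (Sum.inr q) = Sum.inr y := by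
    obtain ⟨u | q, hu⟩ := (isoSquareReplace σ).surjective (Sum.inr y)
    · exact absurd hu Sum.inl_ne_inr
    · exact ⟨q, hu⟩
  rw [← hleft, ← hq] at hadj ⊢
  obtain rfl : a = q.1 := (isoSquareReplace σ).map_adj_iff.mp hadj
  simp only [Iso.mcount_map_eq]
  exact ⟨mcount_left_new q, mcount_new_left q⟩

end bipartiteSquare

/-- Let `m ≥ 3` and `O = O(K_{m,m})` be obtained from `K_{m,m}` by replacing
each edge with a square. For every edge `f = g y` of `O` with `g` an original vertex and
`y = (e, i)` a new vertex, `m_g(f) = 2m² - 1` and `m_y(f) = 4m - 3`. -/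
theorem squareReplace_completeBipartite_mcount (m : ℕ) (hm : 3 ≤ m)
    (g : Fin m ⊕ Fin m)
    (y : (completeBipartiteGraph (Fin m) (Fin m)).edgeSet × Fin 2)
    (hadj : (squareReplace (completeBipartiteGraph (Fin m) (Fin m))).Adj
      (Sum.inl g) (Sum.inr y)) :
    mcount (squareReplace (completeBipartiteGraph (Fin m) (Fin m))) (Sum.inl g) (Sum.inr y)
        = 2 * m ^ 2 - 1 ∧
    mcount (squareReplace (completeBipartiteGraph (Fin m) (Fin m))) (Sum.inr y) (Sum.inl g)
        = 4 * m - 3 := by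
  rcases g with a | a
  · exact bipartiteSquare.mcount_squareReplace Iso.refl a y hadj
  · exact bipartiteSquare.mcount_squareReplace
      ⟨Equiv.sumComm _ _, by rintro (u | u) (v | v) <;> simp⟩ a y hadj
end

section
/- Let m ≥ 3 and let O be the graph obtained from the complete bipartite graph K_{m,m} by replacing each edge with a square: vertex set V(K_{m,m}) ⊔ (E(K_{m,m}) × {0,1}), with an original vertex v adjacent to (e,i) iff v is an endpoint of e, and no other adjacencies. For a rational λ > 1, O is edge quasi-λ-distance-balanced (λ-EQDB) if and only if λ = (2m² − 1)/(4m − 3); moreover, for every edge f = gh of O, m_0(f) = 2m² − 4m + 3. -/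
open SimpleGraph

section Transport

variable {V W : Type*} {G : SimpleGraph V} {G' : SimpleGraph W}

theorem SimpleGraph.Iso.dist_map_le (φ : G ≃g G') (hG : G.Connected) (u v : V) :
    G'.dist (φ u) (φ v) ≤ G.dist u v := by
  obtain ⟨p, hp⟩ := hG.exists_walk_length_eq_dist u v
  have := dist_le (p.map φ.toHom)
  rw [Walk.length_map, hp] at this
  exact this

theorem SimpleGraph.Iso.dist_map (φ : G ≃g G') (hG : G.Connected) (u v : V) :
    G'.dist (φ u) (φ v) = G.dist u v := by
  refine le_antisymm (φ.dist_map_le hG u v) ?_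
  simpa using φ.symm.dist_map_le (φ.connected_iff.mp hG) (φ u) (φ v)

theorem evdist_map (φ : G ≃g G') (hG : G.Connected) (g : V) (e : Sym2 V) :
    evdist G' (φ g) (e.map φ) = evdist G g e := by
  induction e with
  | _ u v => simp [evdist, φ.dist_map hG]

theorem ncard_edgeSet_map (φ : G ≃g G') (p : Sym2 V → Prop) (q : Sym2 W → Prop)
    (h : ∀ e, q (e.map φ) ↔ p e) :
    {e ∈ G'.edgeSet | q e}.ncard = {e ∈ G.edgeSet | p e}.ncard := by
  rw [← Set.ncard_image_of_injective _ (Sym2.map.injective φ.injective)]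
  congr 1
  ext e
  simp only [Set.mem_ofPred_eq, Set.mem_image]
  constructor
  · rintro ⟨he, hq⟩
    have hmap : (e.map φ.symm).map φ = e := by
      induction e with
      | _ u v => simp
    refine ⟨e.map φ.symm, ⟨?_, (h _).1 (by rwa [hmap])⟩, hmap⟩
    induction e with
    | _ u v => exact φ.symm.map_adj_iff.2 he
  · rintro ⟨e, ⟨he, hp⟩, rfl⟩
    refine ⟨?_, (h e).2 hp⟩
    induction e with
    | _ u v => exact φ.map_adj_iff.2 he

theorem mcount_map (φ : G ≃g G') (hG : G.Connected) (g h : V) :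
    mcount G' (φ g) (φ h) = mcount G g h :=
  ncard_edgeSet_map φ _ _ fun e => by simp only [evdist_map φ hG]

theorem m0count_map (φ : G ≃g G') (hG : G.Connected) (g h : V) :
    m0count G' (φ g) (φ h) = m0count G g h :=
  ncard_edgeSet_map φ _ _ fun e => by
    rw [evdist_map φ hG, evdist_map φ hG, ← Sym2.map_mk,
      (Sym2.map.injective φ.injective).ne_iff]

theorem m0count_comm (g h : V) : m0count G g h = m0count G h g := by
  simp only [m0count, Sym2.eq_swap (a := g), eq_comm]

/-- A function that vanishes only at `u`, changes by at most one along edges and decreases to some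
neighbour of every vertex other than `u` is the distance from `u`. -/
theorem reachable_and_dist_eq_of_descent (u : V) (f : V → ℕ) (hzero : f u = 0)
    (hlip : ∀ v w, G.Adj v w → f v ≤ f w + 1)
    (hdesc : ∀ v, v ≠ u → ∃ w, G.Adj v w ∧ f w < f v) (v : V) :
    G.Reachable u v ∧ G.dist u v = f v := by
  have hwalk : ∀ n v, f v = n → ∃ p : G.Walk v u, p.length ≤ n := by
    intro n
    induction n using Nat.strong_induction_on with
    | _ n ih =>
      intro v hv
      by_cases hvu : v = u
      · subst hvu
        exact ⟨Walk.nil, by simp⟩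
      · obtain ⟨w, hvw, hlt⟩ := hdesc v hvu
        obtain ⟨p, hp⟩ := ih (f w) (hv ▸ hlt) w rfl
        exact ⟨Walk.cons hvw p, by rw [Walk.length_cons]; omega⟩
  have hlower : ∀ {v} (p : G.Walk v u), f v ≤ p.length := by
    intro v p
    induction p with
    | nil => simp [hzero]
    | cons h p ih =>
      have := hlip _ _ h
      have := ih hzero hdesc hwalk
      rw [Walk.length_cons]
      omega
  obtain ⟨p, hp⟩ := hwalk _ v rfl
  refine ⟨p.reachable.symm, ?_⟩
  obtain ⟨q, hq⟩ := p.reachable.exists_walk_length_eq_dist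
  rw [dist_comm]
  exact le_antisymm ((dist_le p).trans hp) (hq ▸ hlower q)

end Transport

section Grid

variable {m : ℕ}

/-- Pairs of indices enumerate the edges of a complete bipartite graph. -/
noncomputable def completeBipartiteEdgeEquiv (m : ℕ) :
    Fin m × Fin m ≃ (completeBipartiteGraph (Fin m) (Fin m)).edgeSet :=
  Equiv.ofBijective (fun p => ⟨s(Sum.inl p.1, Sum.inr p.2), by simp⟩) <| by
    constructor
    · rintro ⟨a, b⟩ ⟨a', b'⟩ h
      simpa using h
    · rintro ⟨e, he⟩
      induction e with
      | _ u v =>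
        rcases u with a | b <;> rcases v with a' | b'
        · simp at he
        · exact ⟨(a, b'), rfl⟩
        · exact ⟨(a', b), Subtype.ext Sym2.eq_swap⟩
        · simp at he

/-- The vertices of the square replacement of `K_{m,m}` in coordinates. -/
abbrev GridVertex (m : ℕ) := (Fin m ⊕ Fin m) ⊕ ((Fin m × Fin m) × Fin 2)

/-- The coordinate description of the vertices of the square replacement of `K_{m,m}`. -/
noncomputable def gridEquiv (m : ℕ) : GridVertex m ≃
    (Fin m ⊕ Fin m) ⊕ ((completeBipartiteGraph (Fin m) (Fin m)).edgeSet × Fin 2) :=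
  Equiv.sumCongr (Equiv.refl _) (Equiv.prodCongr (completeBipartiteEdgeEquiv m) (Equiv.refl _))

/-- The square replacement of `K_{m,m}` in coordinates. -/
noncomputable def grid (m : ℕ) : SimpleGraph (GridVertex m) :=
  (squareReplace (completeBipartiteGraph (Fin m) (Fin m))).comap (gridEquiv m)

/-- The coordinate description as a graph isomorphism. -/
noncomputable def gridIso (m : ℕ) :
    grid m ≃g squareReplace (completeBipartiteGraph (Fin m) (Fin m)) :=
  Iso.comap (gridEquiv m) _

@[simp] theorem grid_adj_inl_inl (x y : Fin m ⊕ Fin m) :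
    ¬(grid m).Adj (Sum.inl x) (Sum.inl y) := id

@[simp] theorem grid_adj_inr_inr (x y : (Fin m × Fin m) × Fin 2) :
    ¬(grid m).Adj (Sum.inr x) (Sum.inr y) := id

@[simp] theorem grid_adj_left (a : Fin m) (x : (Fin m × Fin m) × Fin 2) :
    (grid m).Adj (Sum.inl (Sum.inl a)) (Sum.inr x) ↔ a = x.1.1 := by
  change Sum.inl a ∈ s(Sum.inl x.1.1, Sum.inr x.1.2) ↔ _
  simp

@[simp] theorem grid_adj_right (b : Fin m) (x : (Fin m × Fin m) × Fin 2) :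
    (grid m).Adj (Sum.inl (Sum.inr b)) (Sum.inr x) ↔ b = x.1.2 := by
  change Sum.inr b ∈ s(Sum.inl x.1.1, Sum.inr x.1.2) ↔ _
  simp

@[simp] theorem grid_adj_left' (a : Fin m) (x : (Fin m × Fin m) × Fin 2) :
    (grid m).Adj (Sum.inr x) (Sum.inl (Sum.inl a)) ↔ a = x.1.1 := by
  rw [adj_comm, grid_adj_left]

@[simp] theorem grid_adj_right' (b : Fin m) (x : (Fin m × Fin m) × Fin 2) :
    (grid m).Adj (Sum.inr x) (Sum.inl (Sum.inr b)) ↔ b = x.1.2 := by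
  rw [adj_comm, grid_adj_right]

/-- Exchanging the two sides of `K_{m,m}`. -/
def gridSwap (m : ℕ) : grid m ≃g grid m where
  toEquiv := Equiv.sumCongr (Equiv.sumComm _ _)
    (Equiv.prodCongr (Equiv.prodComm _ _) (Equiv.refl _))
  map_rel_iff' := by
    rintro ((a | b) | x) ((a' | b') | y) <;> simp

/-- The distance from the left vertex `a₀`. -/
def cornerDist (a₀ : Fin m) : GridVertex m → ℕ
  | .inl (.inl a) => if a = a₀ then 0 else 4
  | .inl (.inr _) => 2
  | .inr x => if x.1.1 = a₀ then 1 else 3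

/-- The distance from the middle vertex `x₀`. -/
def middleDist (x₀ : (Fin m × Fin m) × Fin 2) : GridVertex m → ℕ
  | .inl (.inl a) => if a = x₀.1.1 then 1 else 3
  | .inl (.inr b) => if b = x₀.1.2 then 1 else 3
  | .inr x => if x = x₀ then 0 else if x.1.1 = x₀.1.1 ∨ x.1.2 = x₀.1.2 then 2 else 4

theorem reachable_and_dist_corner (a₀ : Fin m) (v : GridVertex m) :
    (grid m).Reachable (Sum.inl (Sum.inl a₀)) v ∧
      (grid m).dist (Sum.inl (Sum.inl a₀)) v = cornerDist a₀ v := by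
  apply reachable_and_dist_eq_of_descent
  · simp [cornerDist]
  · rintro ((a | b) | ⟨⟨a, b⟩, i⟩) ((a' | b') | ⟨⟨a', b'⟩, j⟩) <;>
      simp [cornerDist] <;> grind
  · rintro ((a | b) | ⟨⟨a, b⟩, i⟩) hv
    · exact ⟨Sum.inr ((a, a₀), 0), by simp, by grind [cornerDist]⟩
    · exact ⟨Sum.inr ((a₀, b), 0), by simp, by grind [cornerDist]⟩
    · by_cases ha : a = a₀
      · exact ⟨Sum.inl (Sum.inl a), by simp, by grind [cornerDist]⟩
      · exact ⟨Sum.inl (Sum.inr b), by simp, by grind [cornerDist]⟩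

theorem dist_middle (x₀ : (Fin m × Fin m) × Fin 2) (v : GridVertex m) :
    (grid m).dist (Sum.inr x₀) v = middleDist x₀ v := by
  obtain ⟨⟨a₀, b₀⟩, i₀⟩ := x₀
  refine (reachable_and_dist_eq_of_descent _ _ ?_ ?_ ?_ v).2
  · simp [middleDist]
  · rintro ((a | b) | ⟨⟨a, b⟩, i⟩) ((a' | b') | ⟨⟨a', b'⟩, j⟩) <;>
      simp [middleDist] <;> grind
  · rintro ((a | b) | ⟨⟨a, b⟩, i⟩) hv
    · by_cases ha : a = a₀
      · exact ⟨Sum.inr ((a₀, b₀), i₀), by simp [ha], by grind [middleDist]⟩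
      · exact ⟨Sum.inr ((a, b₀), 0), by simp, by grind [middleDist]⟩
    · by_cases hb : b = b₀
      · exact ⟨Sum.inr ((a₀, b₀), i₀), by simp [hb], by grind [middleDist]⟩
      · exact ⟨Sum.inr ((a₀, b), 0), by simp, by grind [middleDist]⟩
    · by_cases hb : b = b₀
      · exact ⟨Sum.inl (Sum.inr b), by simp, by grind [middleDist]⟩
      · exact ⟨Sum.inl (Sum.inl a), by simp, by grind [middleDist]⟩

theorem grid_connected (a₀ : Fin m) : (grid m).Connected :=
  connected_iff_exists_forall_reachable _ |>.2
    ⟨_, fun v => (reachable_and_dist_corner a₀ v).1⟩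

/-- The edges of `grid m` in coordinates: the two edges at each middle vertex. -/
def gridEdge (y : ((Fin m × Fin m) × Fin 2) × Bool) : Sym2 (GridVertex m) :=
  s(Sum.inl (if y.2 then Sum.inl y.1.1.1 else Sum.inr y.1.1.2), Sum.inr y.1)

theorem gridEdge_injective : Function.Injective (gridEdge (m := m)) := by
  rintro ⟨x, s⟩ ⟨y, t⟩ h
  cases s <;> cases t <;> simp [gridEdge] at h ⊢
  · exact h.2
  · exact h.2

theorem range_gridEdge : Set.range (gridEdge (m := m)) = (grid m).edgeSet := by
  ext e
  constructor
  · rintro ⟨⟨x, _ | _⟩, rfl⟩ <;> simp [gridEdge]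
  · induction e with
    | _ u v =>
      rcases u with (a | b) | x <;> rcases v with (a' | b') | y <;> intro h <;> simp at h
      · exact ⟨(y, true), by simp [gridEdge, h]⟩
      · exact ⟨(y, false), by simp [gridEdge, h]⟩
      · exact ⟨(x, true), by simp [gridEdge, h]⟩
      · exact ⟨(x, false), by simp [gridEdge, h]⟩

theorem sum_decide_eq {n : ℕ} (i₀ : Fin n) (F : Bool → ℕ) :
    ∑ i, F (decide (i = i₀)) = F true + (n - 1) * F false := by
  rw [← Finset.add_sum_erase _ _ (Finset.mem_univ i₀)]
  rw [Finset.sum_congr rfl (g := fun _ => F false) fun i hi => by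
    simp [Finset.ne_of_mem_erase hi]]
  simp

/-- Counting edges of `grid m` by a property that depends only on which coordinates agree with
those of a fixed middle vertex. -/
theorem ncard_grid_edgeSet (a₀ b₀ : Fin m) (i₀ : Fin 2) (p : Sym2 (GridVertex m) → Prop)
    (q : Bool → Bool → Bool → Bool → Bool)
    (h : ∀ a b i t, p (gridEdge (((a, b), i), t)) ↔
      q (decide (a = a₀)) (decide (b = b₀)) (decide (i = i₀)) t = true) :
    {e ∈ (grid m).edgeSet | p e}.ncard =
      let F x y := ∑ z, ∑ t, (q x y z t).toNat
      (F true true + (m - 1) * F true false) +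
        (m - 1) * (F false true + (m - 1) * F false false) := by
  classical
  have hset : {e ∈ (grid m).edgeSet | p e} =
      gridEdge '' ↑(Finset.univ.filter fun y => p (gridEdge (m := m) y)) := by
    rw [← range_gridEdge]
    ext e
    simp only [Set.mem_ofPred_eq, Set.mem_range, Set.mem_image, Finset.coe_filter,
      Finset.mem_univ, true_and]
    constructor
    · rintro ⟨⟨y, rfl⟩, hp⟩
      exact ⟨y, hp, rfl⟩
    · rintro ⟨y, hp, rfl⟩
      exact ⟨⟨y, rfl⟩, hp⟩
  rw [hset, Set.ncard_image_of_injective _ gridEdge_injective, Set.ncard_coe_finset,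
    Finset.card_filter]
  simp only [Fintype.sum_prod_type]
  have hF : ∀ x y, ∑ i : Fin 2, ∑ t, (if q x y (decide (i = i₀)) t = true then 1 else 0) =
      ∑ z, ∑ t, (q x y z t).toNat := by
    intro x y
    rw [sum_decide_eq i₀ fun z => ∑ t, if q x y z t = true then 1 else 0]
    simp [Bool.toNat, Bool.cond_eq_ite]
  have hsum : ∀ a b, ∑ i, ∑ t, (if p (gridEdge (((a, b), i), t)) then 1 else 0) =
      ∑ z, ∑ t, (q (decide (a = a₀)) (decide (b = b₀)) z t).toNat := by
    intro a b
    rw [← hF]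
    simp only [h]
  simp only [hsum]
  rw [← sum_decide_eq b₀ fun y => ∑ z, ∑ t, (q true y z t).toNat,
    ← sum_decide_eq b₀ fun y => ∑ z, ∑ t, (q false y z t).toNat,
    ← sum_decide_eq a₀ fun x => ∑ b : Fin m, ∑ z, ∑ t, (q x (decide (b = b₀)) z t).toNat]

theorem evdist_corner_gridEdge (a₀ a b : Fin m) (i : Fin 2) (t : Bool) :
    evdist (grid m) (Sum.inl (Sum.inl a₀)) (gridEdge (((a, b), i), t)) =
      if a = a₀ then (if t then 0 else 1) else (if t then 3 else 2) := by
  cases t <;> simp [evdist, gridEdge, reachable_and_dist_corner, cornerDist] <;> grind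

theorem evdist_middle_gridEdge (a₀ b₀ a b : Fin m) (i₀ i : Fin 2) (t : Bool) :
    evdist (grid m) (Sum.inr ((a₀, b₀), i₀)) (gridEdge (((a, b), i), t)) =
      if a = a₀ ∧ b = b₀ ∧ i = i₀ then 0
      else if t then (if a = a₀ then 1 else if b = b₀ then 2 else 3)
      else (if b = b₀ then 1 else if a = a₀ then 2 else 3) := by
  cases t <;> simp [evdist, gridEdge, dist_middle, middleDist] <;> grind

theorem grid_counts (a₀ b₀ : Fin m) (i₀ : Fin 2) :
    mcount (grid m) (Sum.inl (Sum.inl a₀)) (Sum.inr ((a₀, b₀), i₀)) =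
        2 * (m - 1) ^ 2 + 4 * (m - 1) + 1 ∧
      mcount (grid m) (Sum.inr ((a₀, b₀), i₀)) (Sum.inl (Sum.inl a₀)) = 4 * (m - 1) + 1 ∧
      m0count (grid m) (Sum.inl (Sum.inl a₀)) (Sum.inr ((a₀, b₀), i₀)) =
        2 * (m - 1) ^ 2 + 1 := by
  let corner (x t : Bool) : ℕ := if x then (if t then 0 else 1) else (if t then 3 else 2)
  let middle (x y z t : Bool) : ℕ := if x ∧ y ∧ z then 0
      else if t then (if x then 1 else if y then 2 else 3)
      else (if y then 1 else if x then 2 else 3)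
  refine ⟨?_, ?_, ?_⟩
  · refine (ncard_grid_edgeSet a₀ b₀ i₀ _
      (fun x y z t => decide (corner x t < middle x y z t)) ?_).trans ?_
    · intro a b i t
      simp [evdist_corner_gridEdge, evdist_middle_gridEdge, corner, middle]
    · simp [corner, middle]
      ring
  · refine (ncard_grid_edgeSet a₀ b₀ i₀ _
      (fun x y z t => decide (middle x y z t < corner x t)) ?_).trans ?_
    · intro a b i t
      simp [evdist_corner_gridEdge, evdist_middle_gridEdge, corner, middle]
    · simp [corner, middle]
      ring
  · refine (ncard_grid_edgeSet a₀ b₀ i₀ _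
      (fun x y z t => decide (¬(x ∧ y ∧ z ∧ t) ∧ corner x t = middle x y z t)) ?_).trans ?_
    · intro a b i t
      have hedge : s(Sum.inl (Sum.inl a₀), Sum.inr ((a₀, b₀), i₀)) =
          gridEdge (((a₀, b₀), i₀), true) := rfl
      rw [hedge, gridEdge_injective.ne_iff]
      simp [evdist_corner_gridEdge, evdist_middle_gridEdge, corner, middle, and_assoc]
      tauto
    · simp [corner, middle]
      ring

/-- Every edge of the square replacement of `K_{m,m}` joins an original vertex to a new one, and
the edge counts are the same for all edges. -/
theorem squareReplace_counts {g h}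
    (hgh : (squareReplace (completeBipartiteGraph (Fin m) (Fin m))).Adj g h) :
    let G := squareReplace (completeBipartiteGraph (Fin m) (Fin m))
    m0count G g h = 2 * (m - 1) ^ 2 + 1 ∧
      ((mcount G g h = 2 * (m - 1) ^ 2 + 4 * (m - 1) + 1 ∧ mcount G h g = 4 * (m - 1) + 1) ∨
        (mcount G h g = 2 * (m - 1) ^ 2 + 4 * (m - 1) + 1 ∧ mcount G g h = 4 * (m - 1) + 1)) := by
  intro G
  obtain ⟨g, rfl⟩ := (gridIso m).surjective g
  obtain ⟨h, rfl⟩ := (gridIso m).surjective h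
  rw [Iso.map_adj_iff] at hgh
  have a₀ : Fin m := by
    rcases g with (a | b) | x
    exacts [a, b, x.1.1]
  have hconn := grid_connected a₀
  rw [m0count_map _ hconn, mcount_map _ hconn, mcount_map _ hconn]
  have hright : ∀ (a b : Fin m) (i : Fin 2),
      mcount (grid m) (Sum.inl (Sum.inr b)) (Sum.inr ((a, b), i)) =
          2 * (m - 1) ^ 2 + 4 * (m - 1) + 1 ∧
        mcount (grid m) (Sum.inr ((a, b), i)) (Sum.inl (Sum.inr b)) = 4 * (m - 1) + 1 ∧
        m0count (grid m) (Sum.inl (Sum.inr b)) (Sum.inr ((a, b), i)) = 2 * (m - 1) ^ 2 + 1 := by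
    intro a b i
    have h := grid_counts b a i
    have hl : gridSwap m (Sum.inl (Sum.inl b)) = Sum.inl (Sum.inr b) := rfl
    have hx : gridSwap m (Sum.inr ((b, a), i)) = Sum.inr ((a, b), i) := rfl
    rw [← hl, ← hx]
    simpa only [mcount_map (gridSwap m) hconn, m0count_map (gridSwap m) hconn] using h
  rcases g with (a | b) | ⟨⟨a, b⟩, i⟩ <;> rcases h with (a' | b') | ⟨⟨a', b'⟩, j⟩ <;>
    simp only [grid_adj_inl_inl, grid_adj_inr_inr, grid_adj_left, grid_adj_right,
      grid_adj_left', grid_adj_right'] at hgh <;> subst hgh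
  · obtain ⟨h₁, h₂, h₃⟩ := grid_counts a b' j
    exact ⟨h₃, Or.inl ⟨h₁, h₂⟩⟩
  · obtain ⟨h₁, h₂, h₃⟩ := hright a' b j
    exact ⟨h₃, Or.inl ⟨h₁, h₂⟩⟩
  · obtain ⟨h₁, h₂, h₃⟩ := grid_counts a' b i
    exact ⟨m0count_comm _ _ ▸ h₃, Or.inr ⟨h₁, h₂⟩⟩
  · obtain ⟨h₁, h₂, h₃⟩ := hright a b' i
    exact ⟨m0count_comm _ _ ▸ h₃, Or.inr ⟨h₁, h₂⟩⟩

end Grid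

/-- Let `m ≥ 3` and `O = O(K_{m,m})` be obtained from `K_{m,m}` by replacing
each edge with a square. For a rational `λ > 1`, `O` is edge quasi-λ-distance-balanced iff
`λ = (2m² - 1)/(4m - 3)`; moreover, for every edge `f = gh` of `O`,
`m_0(f) = 2m² - 4m + 3`. -/
theorem squareReplace_completeBipartite_isEQDB_iff (m : ℕ) (hm : 3 ≤ m)
    (lam : ℚ) (hlam : 1 < lam) :
    (IsEQDB (squareReplace (completeBipartiteGraph (Fin m) (Fin m))) lam ↔
      lam = (2 * (m : ℚ) ^ 2 - 1) / (4 * (m : ℚ) - 3)) ∧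
    ∀ g h, (squareReplace (completeBipartiteGraph (Fin m) (Fin m))).Adj g h →
      m0count (squareReplace (completeBipartiteGraph (Fin m) (Fin m))) g h
        = 2 * m ^ 2 - 4 * m + 3 := by
  obtain ⟨n, rfl⟩ : ∃ n, m = n + 1 := ⟨m - 1, by omega⟩
  have hn : (2 : ℚ) ≤ n := by exact_mod_cast (by omega : 2 ≤ n)
  have hden : (0 : ℚ) < 4 * n + 1 := by linarith
  have hratio : (2 * ((n + 1 : ℕ) : ℚ) ^ 2 - 1) / (4 * ((n + 1 : ℕ) : ℚ) - 3) =
      (2 * (n : ℚ) ^ 2 + 4 * n + 1) / (4 * n + 1) := by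
    push_cast
    congr 1 <;> ring
  rw [hratio, eq_div_iff hden.ne']
  refine ⟨⟨fun H => ?_, fun H g h hgh => ?_⟩, fun g h hgh => ?_⟩
  · have hgh : (squareReplace (completeBipartiteGraph (Fin (n + 1)) (Fin (n + 1)))).Adj
        (gridIso _ (Sum.inl (Sum.inl 0))) (gridIso _ (Sum.inr ((0, 0), 0))) := by
      rw [Iso.map_adj_iff, grid_adj_left]
    have hratio_of_le : ∀ x y : ℚ, x = 2 * n ^ 2 + 4 * n + 1 → y = 4 * n + 1 →
        (x = lam * y ∨ y = lam * x) → lam * (4 * n + 1) = 2 * n ^ 2 + 4 * n + 1 := by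
      rintro x y rfl rfl (h | h)
      · exact h.symm
      · nlinarith
    obtain ⟨-, ⟨h₁, h₂⟩ | ⟨h₁, h₂⟩⟩ := squareReplace_counts hgh
    · exact hratio_of_le _ _ (by rw [h₁]; push_cast; simp) (by rw [h₂]; push_cast; simp) (H _ _ hgh)
    · exact hratio_of_le _ _ (by rw [h₁]; push_cast; simp) (by rw [h₂]; push_cast; simp)
        (H _ _ hgh).symm
  · obtain ⟨-, ⟨h₁, h₂⟩ | ⟨h₁, h₂⟩⟩ := squareReplace_counts hgh
    · left
      rw [h₁, h₂]
      push_cast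
      simpa using H.symm
    · right
      rw [h₁, h₂]
      push_cast
      simpa using H.symm
  · rw [(squareReplace_counts hgh).1]
    have : 2 * (n + 1) ^ 2 = 4 * (n + 1) + (2 * n ^ 2) - 2 := by
      have : 2 * (n + 1) ^ 2 + 2 = 4 * (n + 1) + 2 * n ^ 2 := by ring
      omega
    have : 1 ≤ n ^ 2 := Nat.one_le_pow _ _ (by omega)
    simp only [Nat.add_sub_cancel]
    omega
end
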